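/- Let x and y be integers with x, y ≥ 2. Assume that for all but finitely many prime numbers p and for every positive integer m, the implication p ∣ x^m − 1 ⟹ p ∣ y^m − 1 holds. Then x and y are multiplicatively dependent: there exist nonzero integers a and f such that x^a = y^f. (This is the resolution of the support problem of Erdős discussed in the Introduction, obtained from Corollary 6.2 applied to F = ℚ with S the set of primes dividing xy.) -/

import Mathlib

/-!
The support problem of Erdős (resolved by Corrales-Rodrigáñez and Schoof, and recovered
from Corollary 6.2 with `F = ℚ` and `S` the primes dividing `xy`): if `x, y ≥ 2` are
integers such that for all but finitely many primes `p` and all positive exponents `m`,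
`p ∣ x^m − 1` implies `p ∣ y^m − 1`, then `x` and `y` are multiplicatively dependent:
`x^a = y^f` for some nonzero integers `a, f` (the integral powers being computed in `ℚ`).
-/

section Euler
open UniqueFactorizationMonoid
variable {R : Type*} [CommRing R] {w : Ideal R → ℝ}

theorem sum_le_tsum_of_injOn_ideal {ι : Type*} (hw : ∀ I, 0 ≤ w I) (hs : Summable w)
    (S : Finset ι) (φ : ι → Ideal R) (hφ : Set.InjOn φ S) :
    ∑ i ∈ S, w (φ i) ≤ ∑' I, w I := by
  classical
  rw [← Finset.sum_image (f := w) hφ]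
  exact hs.sum_le_tsum _ fun I _ ↦ hw I

variable [IsDedekindDomain R]

theorem prod_primes_one_add_le_tsum (hw : ∀ I, 0 ≤ w I) (hs : Summable w)
    (h1 : w 1 = 1) (hmul : ∀ I J, w (I * J) = w I * w J)
    (F : Finset (Ideal R)) (hF : ∀ P ∈ F, Prime P) :
    ∏ P ∈ F, (1 + w P) ≤ ∑' I, w I := by
  classical
  let wh : Ideal R →* ℝ := ⟨⟨w, h1⟩, hmul⟩
  have hp (T : Finset (Ideal R)) : ∏ P ∈ T, w P = w (∏ P ∈ T, P) := (map_prod wh _ T).symm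
  rw [Finset.prod_one_add]
  simp_rw [hp]
  refine sum_le_tsum_of_injOn_ideal hw hs _ _ fun S hS T hT h ↦ ?_
  have key : ∀ {S T : Finset (Ideal R)}, S ⊆ F → T ⊆ F → ∏ P ∈ S, P = ∏ P ∈ T, P → S ⊆ T := by
    intro S T hS hT h P hP
    have hd : P ∣ ∏ Q ∈ T, Q := h ▸ Finset.dvd_prod_of_mem _ hP
    obtain ⟨Q, hQ, hPQ⟩ := (hF P (hS hP)).exists_mem_finset_dvd hd
    have := associated_iff_eq.1 ((hF P (hS hP)).associated_of_dvd (hF Q (hT hQ)) hPQ)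
    exact this ▸ hQ
  simp only [Finset.coe_powerset, Set.mem_preimage, Set.mem_powerset_iff, Finset.coe_subset] at hS hT
  exact (key hS hT h).antisymm (key hT hS h.symm)

theorem sum_le_prod_primes_inv_one_sub (hw : ∀ I, 0 ≤ w I) (h0 : w 0 = 0) (h1 : w 1 = 1)
    (hmul : ∀ I J, w (I * J) = w I * w J) (hlt : ∀ P, Prime P → w P < 1) (G : Finset (Ideal R)) :
    ∃ F : Finset (Ideal R), (∀ P ∈ F, Prime P) ∧ ∑ I ∈ G, w I ≤ ∏ P ∈ F, (1 - w P)⁻¹ := by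
  classical
  let wh : Ideal R →* ℝ := ⟨⟨w, h1⟩, hmul⟩
  let G' := G.filter (· ≠ 0)
  let F := G'.biUnion fun I ↦ (normalizedFactors I).toFinset
  let v : Ideal R → Ideal R → ℕ := fun I P ↦ (normalizedFactors I).count P
  have hF : ∀ P ∈ F, Prime P := by
    intro P hP
    obtain ⟨I, -, hI⟩ := Finset.mem_biUnion.1 hP
    exact prime_of_normalized_factor P (Multiset.mem_toFinset.1 hI)
  have hprod : ∀ I ∈ G', I = ∏ P ∈ F, P ^ v I P := by
    intro I hI
    have hI0 : I ≠ 0 := (Finset.mem_filter.1 hI).2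
    have h := associated_iff_eq.1 (prod_normalizedFactors hI0)
    conv_lhs => rw [← h]
    exact Finset.prod_multiset_count_of_subset _ _
      (Finset.subset_biUnion_of_mem (fun I ↦ (normalizedFactors I).toFinset) hI)
  let E := G'.sup (fun I ↦ F.sup (v I)) + 1
  have hE : ∀ I ∈ G', ∀ P ∈ F, v I P ∈ Finset.range E := by
    intro I hI P hP
    refine Finset.mem_range.2 (Nat.lt_succ_of_le ?_)
    exact (Finset.le_sup (f := v I) hP).trans (Finset.le_sup (f := fun I ↦ F.sup (v I)) hI)
  refine ⟨F, hF, ?_⟩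
  calc ∑ I ∈ G, w I = ∑ I ∈ G', w I := by
        refine (Finset.sum_filter_of_ne fun I _ h ↦ ?_).symm
        rintro rfl; exact h h0
    _ = ∑ I ∈ G', ∏ P ∈ F.attach, w P ^ v I P := by
        refine Finset.sum_congr rfl fun I hI ↦ ?_
        rw [Finset.prod_attach F (fun P ↦ w P ^ v I P)]
        conv_lhs => rw [hprod I hI]
        change wh _ = _
        rw [map_prod]
        simp only [map_pow]; rfl
    _ ≤ ∑ e ∈ F.pi fun _ ↦ Finset.range E, ∏ P ∈ F.attach, w P.1 ^ e P.1 P.2 := by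
        have hinj : Set.InjOn (fun (I : Ideal R) (P : Ideal R) (_ : P ∈ F) ↦ v I P) G' := by
          intro I hI J hJ h
          rw [hprod I hI, hprod J hJ]
          exact Finset.prod_congr rfl fun P hP ↦
            congrArg (P ^ ·) (congrFun (congrFun h P) hP)
        rw [← Finset.sum_image (f := fun e : (P : Ideal R) → P ∈ F → ℕ ↦
          ∏ P ∈ F.attach, w P.1 ^ e P.1 P.2) hinj]
        refine Finset.sum_le_sum_of_subset_of_nonneg ?_ fun e _ _ ↦
          Finset.prod_nonneg fun P _ ↦ pow_nonneg (hw _) _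
        intro e he
        obtain ⟨I, hI, rfl⟩ := Finset.mem_image.1 he
        exact Finset.mem_pi.2 fun P hP ↦ hE I hI P hP
    _ = ∏ P ∈ F, ∑ k ∈ Finset.range E, w P ^ k :=
        (Finset.prod_sum F (fun _ ↦ Finset.range E) fun P k ↦ w P ^ k).symm
    _ ≤ ∏ P ∈ F, (1 - w P)⁻¹ := by
        refine Finset.prod_le_prod (fun P _ ↦ Finset.sum_nonneg fun _ _ ↦ pow_nonneg (hw P) _)
          fun P hP ↦ ?_
        rw [← tsum_geometric_of_lt_one (hw P) (hlt P (hF P hP))]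
        exact (summable_geometric_of_lt_one (hw P) (hlt P (hF P hP))).sum_le_tsum _
          fun _ _ ↦ pow_nonneg (hw P) _

theorem abs_tsum_primes_sub_log_tsum_le (hw : ∀ I, 0 ≤ w I) (hs : Summable w) (h0 : w 0 = 0)
    (h1 : w 1 = 1) (hmul : ∀ I J, w (I * J) = w I * w J) (hle : ∀ P, Prime P → w P ≤ 1 / 2) :
    |∑' P : {P : Ideal R // Prime P}, w P - Real.log (∑' I, w I)| ≤
      ∑' P : {P : Ideal R // Prime P}, w P ^ 2 := by
  have hsP : Summable fun P : {P : Ideal R // Prime P} ↦ w P := hs.subtype _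
  have hsP2 : Summable fun P : {P : Ideal R // Prime P} ↦ w P ^ 2 := by
    refine hsP.of_nonneg_of_le (fun P ↦ sq_nonneg _) fun P ↦ ?_
    nlinarith [hw P, hle P P.2]
  have hZ : 1 ≤ ∑' I, w I := h1 ▸ hs.le_tsum 1 fun I _ ↦ hw I
  have hmap (S : Finset {P : Ideal R // Prime P}) :
      ∀ P ∈ S.map (Function.Embedding.subtype _), Prime P := by
    simp +contextual
  rw [abs_sub_le_iff]
  constructor
  · rw [sub_le_iff_le_add, ← sub_le_iff_le_add', ← hsP.tsum_sub hsP2]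
    refine (hsP.sub hsP2).tsum_le_of_sum_le fun S ↦ ?_
    rw [Real.le_log_iff_exp_le (by linarith), Real.exp_sum]
    refine le_trans ?_ (prod_primes_one_add_le_tsum hw hs h1 hmul
      (S.map (Function.Embedding.subtype _)) (hmap S))
    rw [Finset.prod_map]
    refine Finset.prod_le_prod (fun _ _ ↦ (Real.exp_pos _).le) fun P _ ↦ ?_
    have hp0 := hw P
    have hp1 := hle P P.2
    change Real.exp (w P - w P ^ 2) ≤ 1 + w P
    have h := Real.add_one_le_exp (-(w P - w P ^ 2))
    rw [Real.exp_neg] at h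
    have h2 : Real.exp (w P - w P ^ 2) ≤ (-(w P - w P ^ 2) + 1)⁻¹ :=
      (le_inv_comm₀ (by nlinarith) (Real.exp_pos _)).1 h
    refine h2.trans ?_
    rw [inv_le_iff_one_le_mul₀ (by nlinarith)]
    nlinarith [pow_nonneg hp0 3]
  · rw [sub_le_iff_le_add', ← hsP.tsum_add hsP2, Real.log_le_iff_le_exp (by linarith)]
    refine hs.tsum_le_of_sum_le fun G ↦ ?_
    obtain ⟨F, hF, hG⟩ := sum_le_prod_primes_inv_one_sub hw h0 h1 hmul
      (fun P hP ↦ (hle P hP).trans_lt (by norm_num)) G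
    refine hG.trans ?_
    have hF' : ∑ P ∈ F, (w P + w P ^ 2) ≤
        ∑' P : {P : Ideal R // Prime P}, (w P + w P ^ 2) := by
      classical
      rw [← Finset.sum_subtype_of_mem (p := Prime) (fun P ↦ w P + w P ^ 2) hF]
      exact (hsP.add hsP2).sum_le_tsum _ fun P _ ↦ add_nonneg (hw P) (sq_nonneg _)
    refine le_trans ?_ (Real.exp_le_exp.2 hF')
    rw [Real.exp_sum]
    refine Finset.prod_le_prod (fun P hP ↦ inv_nonneg.2 (by linarith [hle P (hF P hP)]))
      fun P hP ↦ ?_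
    have hp0 := hw P
    have hp1 := hle P (hF P hP)
    have h := Real.quadratic_le_exp_of_nonneg (x := w P + w P ^ 2) (by positivity)
    rw [inv_le_iff_one_le_mul₀ (by linarith)]
    refine le_trans ?_ (mul_le_mul_of_nonneg_right h (show 0 ≤ 1 - w P by linarith))
    have h3 : 0 ≤ w P ^ 2 * (1 / 2 - w P) := mul_nonneg (sq_nonneg _) (by linarith)
    have h4 : 0 ≤ w P ^ 3 * (1 / 2 - w P) := mul_nonneg (pow_nonneg hp0 3) (by linarith)
    have h5 : 0 ≤ w P ^ 4 * (1 / 2 - w P) := mul_nonneg (pow_nonneg hp0 4) (by linarith)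
    nlinarith [pow_nonneg hp0 3, pow_nonneg hp0 2, pow_nonneg hp0 4, pow_nonneg hp0 5]
end Euler
section Fibers
variable {α : Type*} {g : α → ℕ} {h : ℕ → ℝ}

theorem summable_comp_iff_summable_card_fiber_mul (hg : ∀ n, Finite {a // g a = n})
    (hh : ∀ n, 0 ≤ h n) :
    Summable (fun a ↦ h (g a)) ↔ Summable fun n ↦ (Nat.card {a // g a = n} : ℝ) * h n := by
  have hc : ∀ n, (fun a : {a // g a = n} ↦ h (g a)) = fun _ ↦ h n := fun n ↦ by
    ext ⟨a, ha⟩; simp [ha]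
  rw [← (Equiv.sigmaFiberEquiv g).summable_iff,
    summable_sigma_of_nonneg (f := (fun a ↦ h (g a)) ∘ _) fun _ ↦ hh _]
  refine (and_iff_right fun n ↦ ?_).trans ?_
  · have := hg n
    exact Summable.of_finite ..
  · refine summable_congr fun n ↦ ?_
    simpa using congrArg tsum (hc n)

theorem tsum_comp_eq_tsum_card_fiber_mul (hg : ∀ n, Finite {a // g a = n}) (hh : ∀ n, 0 ≤ h n) :
    ∑' a, h (g a) = ∑' n, (Nat.card {a // g a = n} : ℝ) * h n := by
  by_cases hs : Summable fun a ↦ h (g a)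
  · have hc : ∀ n, (fun a : {a // g a = n} ↦ h (g a)) = fun _ ↦ h n := fun n ↦ by
      ext ⟨a, ha⟩; simp [ha]
    rw [← (Equiv.sigmaFiberEquiv g).tsum_eq fun a ↦ h (g a),
      Summable.tsum_sigma' (f := fun c ↦ h (g (Equiv.sigmaFiberEquiv g c))) _
        ((Equiv.sigmaFiberEquiv g).summable_iff.2 hs)]
    · refine tsum_congr fun n ↦ ?_
      simpa using congrArg tsum (hc n)
    · intro n
      have := hg n
      exact Summable.of_finite ..
  · rw [tsum_eq_zero_of_not_summable hs, tsum_eq_zero_of_not_summable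
      (mt (summable_comp_iff_summable_card_fiber_mul hg hh).2 hs)]

theorem summable_comp_of_card_fiber_le (hg : ∀ n, Finite {a // g a = n}) (hh : ∀ n, 0 ≤ h n)
    (hs : Summable h) {d : ℕ} (hd : ∀ n, Nat.card {a // g a = n} ≤ d) :
    Summable fun a ↦ h (g a) :=
  (summable_comp_iff_summable_card_fiber_mul hg hh).2 <|
    (hs.mul_left (d : ℝ)).of_nonneg_of_le (fun n ↦ mul_nonneg (Nat.cast_nonneg _) (hh n))
      fun n ↦ mul_le_mul_of_nonneg_right (by exact_mod_cast hd n) (hh n)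

end Fibers

section Zeta
open NumberField Ideal Filter Topology
variable (K : Type*) [Field K] [NumberField K]

theorem dedekindZeta_eq_tsum_ideal {s : ℝ} (hs : s ≠ 0) :
    dedekindZeta K s = ((∑' I : Ideal (𝓞 K), (absNorm I : ℝ) ^ (-s) : ℝ) : ℂ) := by
  rw [tsum_comp_eq_tsum_card_fiber_mul (h := fun n ↦ (n : ℝ) ^ (-s))
    (fun n ↦ finite_setOfPred_absNorm_eq n) (fun n ↦ by positivity), dedekindZeta, LSeries,
    Complex.ofReal_tsum]
  refine tsum_congr fun n ↦ ?_
  rcases eq_or_ne n 0 with rfl | hn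
  · simp [Real.zero_rpow (neg_ne_zero.2 hs)]
  · rw [LSeries.term_of_ne_zero hn, Real.rpow_neg (by positivity), Complex.ofReal_mul,
      Complex.ofReal_inv, Complex.ofReal_cpow (by positivity), div_eq_mul_inv]
    simp

theorem tendsto_sub_one_mul_tsum_ideal :
    Tendsto (fun s : ℝ ↦ (s - 1) * ∑' I : Ideal (𝓞 K), (absNorm I : ℝ) ^ (-s)) (𝓝[>] 1)
      (𝓝 (dedekindZeta_residue K)) := by
  have h := (Complex.continuous_re.tendsto _).comp (tendsto_sub_one_mul_dedekindZeta_nhdsGT K)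
  refine (h.congr' ?_)
  filter_upwards [self_mem_nhdsWithin] with s hs
  have hs : s ≠ 0 := by
    have : (1 : ℝ) < s := hs
    linarith
  rw [Function.comp_apply, dedekindZeta_eq_tsum_ideal K hs]
  norm_cast

theorem eventually_tsum_ideal_pos :
    ∀ᶠ s : ℝ in 𝓝[>] 1, 0 < ∑' I : Ideal (𝓞 K), (absNorm I : ℝ) ^ (-s) := by
  filter_upwards [(tendsto_sub_one_mul_tsum_ideal K).eventually_const_lt (dedekindZeta_residue_pos K),
    self_mem_nhdsWithin] with s hs h1
  exact (mul_pos_iff_of_pos_left (sub_pos.2 h1)).1 hs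

theorem eventually_summable_absNorm_rpow :
    ∀ᶠ s : ℝ in 𝓝[>] 1, Summable fun I : Ideal (𝓞 K) ↦ (absNorm I : ℝ) ^ (-s) := by
  filter_upwards [eventually_tsum_ideal_pos K] with s hs
  by_contra h
  rw [tsum_eq_zero_of_not_summable h] at hs
  exact hs.false

theorem exists_eventually_abs_log_tsum_ideal_add_log_sub_one_le :
    ∃ C : ℝ, ∀ᶠ s : ℝ in 𝓝[>] 1,
      |Real.log (∑' I : Ideal (𝓞 K), (absNorm I : ℝ) ^ (-s)) + Real.log (s - 1)| ≤ C := by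
  have h := ((Real.continuousAt_log (dedekindZeta_residue_ne_zero K)).tendsto.comp
    (tendsto_sub_one_mul_tsum_ideal K)).abs
  refine ⟨|Real.log (dedekindZeta_residue K)| + 1, ?_⟩
  filter_upwards [eventually_tsum_ideal_pos K, self_mem_nhdsWithin,
    h.eventually_le_const (lt_add_one _)] with s hs h1 h
  rw [Function.comp_apply, Real.log_mul (sub_pos.2 h1).ne' hs.ne', add_comm] at h
  exact h

end Zeta

section PrimeWeight

/-- The weight `n⁻ˢ` if `n` is a prime number, and `0` otherwise. -/
noncomputable def primeWeight (s : ℝ) (n : ℕ) : ℝ := if n.Prime then (n : ℝ) ^ (-s) else 0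

theorem primeWeight_nonneg (s : ℝ) (n : ℕ) : 0 ≤ primeWeight s n := by
  rw [primeWeight]
  positivity

theorem primeWeight_le_one {s : ℝ} (hs : 0 ≤ s) (n : ℕ) : primeWeight s n ≤ 1 := by
  rw [primeWeight]
  split_ifs with hn
  · exact Real.rpow_le_one_of_one_le_of_nonpos (by exact_mod_cast hn.one_le) (neg_nonpos.2 hs)
  · exact zero_le_one

theorem summable_mul_primeWeight {u : ℕ → ℝ} {d s : ℝ} (hs : 1 < s) (h0 : ∀ n, 0 ≤ u n)
    (hd : ∀ n : ℕ, n.Prime → u n ≤ d) : Summable fun n ↦ u n * primeWeight s n := by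
  refine ((Real.summable_nat_rpow.2 (neg_lt_neg hs)).mul_left d).of_nonneg_of_le
    (fun n ↦ mul_nonneg (h0 n) (primeWeight_nonneg s n)) fun n ↦ ?_
  rw [primeWeight]
  split_ifs with hn
  · exact mul_le_mul_of_nonneg_right (hd n hn) (by positivity)
  · have := (h0 2).trans (hd 2 Nat.prime_two)
    rw [mul_zero]
    positivity

theorem tsum_mul_primeWeight_le {u v : ℕ → ℝ} {s : ℝ} (hs : 0 ≤ s) (S : Finset ℕ)
    (huv : ∀ n : ℕ, n.Prime → n ∉ S → u n ≤ v n)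
    (hu : Summable fun n ↦ u n * primeWeight s n) (hv : Summable fun n ↦ v n * primeWeight s n) :
    ∑' n, u n * primeWeight s n ≤ ∑' n, v n * primeWeight s n + ∑ n ∈ S, |u n - v n| := by
  classical
  let k (n : ℕ) : ℝ := if n ∈ S then |u n - v n| else 0
  have hk0 : ∀ n ∉ S, k n = 0 := fun n hn ↦ if_neg hn
  have hk : Summable k := summable_of_ne_finset_zero hk0
  have hksum : ∑' n, k n = ∑ n ∈ S, |u n - v n| :=
    (tsum_eq_sum hk0).trans (Finset.sum_congr rfl fun n hn ↦ if_pos hn)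
  rw [← hksum, ← hv.tsum_add hk]
  refine hu.tsum_le_tsum (fun n ↦ ?_) (hv.add hk)
  have h0 := primeWeight_nonneg s n
  have h1 := primeWeight_le_one hs n
  by_cases hn : n ∈ S
  · have := le_abs_self (u n - v n)
    have := abs_nonneg (u n - v n)
    simp only [k, if_pos hn]
    nlinarith
  · simp only [k, if_neg hn, add_zero]
    by_cases hp : n.Prime
    · exact mul_le_mul_of_nonneg_right (huv n hp hn) h0
    · simp [primeWeight, hp]

end PrimeWeight

section PrimeIdeals
open NumberField Ideal Filter Topology
variable {K : Type*} [Field K] [NumberField K]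

theorem exists_prime_absNorm_eq_pow {P : Ideal (𝓞 K)} (hP : Prime P) :
    (absNorm P).minFac.Prime ∧ P.LiesOver (span {((absNorm P).minFac : ℤ)}) ∧
      ∃ f, 0 < f ∧ absNorm P = (absNorm P).minFac ^ f := by
  have := isPrime_of_prime hP
  have hne : P.under ℤ ≠ ⊥ := under_ne_bot ℤ hP.ne_zero
  obtain ⟨p, hp, hPp⟩ : ∃ p : ℕ, p.Prime ∧ P.under ℤ = span {(p : ℤ)} := by
    obtain ⟨a, ha⟩ := (IsPrincipalIdealRing.principal (P.under ℤ)).principal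
    rw [submodule_span_eq] at ha
    have hpr : (P.under ℤ).IsPrime := inferInstance
    rw [ha, ne_eq, span_singleton_eq_bot] at hne
    refine ⟨a.natAbs, Int.prime_iff_natAbs_prime.1 ?_, by rw [ha, Int.span_natAbs]⟩
    rwa [ha, span_singleton_prime hne] at hpr
  have hlies : P.LiesOver (span {(p : ℤ)}) := ⟨hPp.symm⟩
  have hnorm := pow_inertiaDeg p P
  have hf : 0 < P.inertiaDeg ℤ := inertiaDeg_pos P ℤ
  have hmin : (absNorm P).minFac = p := by
    rw [← hnorm, hp.pow_minFac hf.ne']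
  rw [hmin]
  exact ⟨hp, hlies, _, hf, hnorm.symm⟩

theorem finite_card_fiber_minFac_absNorm_le (n : ℕ) :
    Finite {P : {P : Ideal (𝓞 K) // Prime P} // (absNorm P.1).minFac = n} ∧
      Nat.card {P : {P : Ideal (𝓞 K) // Prime P} // (absNorm P.1).minFac = n} ≤
        Module.finrank ℤ (𝓞 K) := by
  by_cases hn : n.Prime
  · have hn0 : span {(n : ℤ)} ≠ ⊥ := by simpa using hn.ne_zero
    have : (span {(n : ℤ)}).IsMaximal := by
      have : Fact n.Prime := ⟨hn⟩
      exact Int.ideal_span_isMaximal_of_prime n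
    let φ (P : {P : {P : Ideal (𝓞 K) // Prime P} // (absNorm P.1).minFac = n}) :
        primesOver (span {(n : ℤ)}) (𝓞 K) :=
      ⟨P.1.1, isPrime_of_prime P.1.2, by
        have := (exists_prime_absNorm_eq_pow P.1.2).2.1
        rwa [P.2] at this⟩
    have hφ : φ.Injective := fun P Q h ↦ Subtype.ext (Subtype.ext (congrArg Subtype.val h :))
    have hfin : Finite (primesOver (span {(n : ℤ)}) (𝓞 K)) :=
      IsDedekindDomain.primesOver_finite _ _
    let := Fintype.ofFinite (primesOver (span {(n : ℤ)}) (𝓞 K))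
    refine ⟨Finite.of_injective φ hφ, (Nat.card_le_card_of_injective φ hφ).trans ?_⟩
    rw [← sum_ramification_inertia_eq_finrank (span {(n : ℤ)}) (𝓞 K), Nat.card_eq_fintype_card,
      Fintype.card_eq_sum_ones]
    refine Finset.sum_le_sum fun Q _ ↦ Nat.mul_pos ?_ (inertiaDeg_pos Q.1 ℤ)
    exact ramificationIdx_pos Q.1 ℤ
  · have : IsEmpty {P : {P : Ideal (𝓞 K) // Prime P} // (absNorm P.1).minFac = n} :=
      ⟨fun P ↦ hn (P.2 ▸ (exists_prime_absNorm_eq_pow P.1.2).1)⟩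
    exact ⟨inferInstance, by simp⟩

variable (K) in
theorem summable_minFac_absNorm_rpow_neg_two :
    Summable fun P : {P : Ideal (𝓞 K) // Prime P} ↦ ((absNorm P.1).minFac : ℝ) ^ (-2 : ℝ) :=
  summable_comp_of_card_fiber_le (g := fun P : {P : Ideal (𝓞 K) // Prime P} ↦ (absNorm P.1).minFac)
    (h := fun n ↦ (n : ℝ) ^ (-2 : ℝ)) (fun n ↦ (finite_card_fiber_minFac_absNorm_le n).1)
    (fun n ↦ by positivity) (Real.summable_nat_rpow.2 (by norm_num))
    fun n ↦ (finite_card_fiber_minFac_absNorm_le n).2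

theorem absNorm_rpow_le_minFac_rpow {P : Ideal (𝓞 K)} (hP : Prime P) {s : ℝ} (hs : 1 ≤ s) :
    (absNorm P : ℝ) ^ (-s) ≤ ((absNorm P).minFac : ℝ) ^ (-1 : ℝ) := by
  obtain ⟨hp, -, f, hf, h⟩ := exists_prime_absNorm_eq_pow hP
  generalize (absNorm P).minFac = p at *
  have hp1 : (1 : ℝ) ≤ p := by exact_mod_cast hp.one_le
  rw [h, Nat.cast_pow, ← Real.rpow_natCast, ← Real.rpow_mul (by positivity)]
  refine Real.rpow_le_rpow_of_exponent_le hp1 ?_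
  have : (1 : ℝ) ≤ f := by exact_mod_cast hf
  nlinarith

theorem absNorm_rpow_le_minFac_rpow_neg_two {P : Ideal (𝓞 K)} (hP : Prime P)
    (hnp : ¬ (absNorm P).Prime) {s : ℝ} (hs : 1 ≤ s) :
    (absNorm P : ℝ) ^ (-s) ≤ ((absNorm P).minFac : ℝ) ^ (-2 : ℝ) := by
  obtain ⟨hp, -, f, hf, h⟩ := exists_prime_absNorm_eq_pow hP
  have hf1 : f ≠ 1 := by
    rintro rfl
    rw [h, pow_one] at hnp
    exact hnp hp
  generalize (absNorm P).minFac = p at *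
  have hp1 : (1 : ℝ) ≤ p := by exact_mod_cast hp.one_le
  rw [h, Nat.cast_pow, ← Real.rpow_natCast, ← Real.rpow_mul (by positivity)]
  refine Real.rpow_le_rpow_of_exponent_le hp1 ?_
  have : (2 : ℝ) ≤ f := by exact_mod_cast (by lia : 2 ≤ f)
  nlinarith

variable (K) in
theorem exists_eventually_abs_tsum_prime_ideals_add_log_le :
    ∃ C : ℝ, ∀ᶠ s : ℝ in 𝓝[>] 1,
      |∑' P : {P : Ideal (𝓞 K) // Prime P}, (absNorm P.1 : ℝ) ^ (-s) + Real.log (s - 1)| ≤ C := by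
  obtain ⟨C, hC⟩ := exists_eventually_abs_log_tsum_ideal_add_log_sub_one_le K
  have hB := summable_minFac_absNorm_rpow_neg_two K
  refine ⟨∑' P : {P : Ideal (𝓞 K) // Prime P}, ((absNorm P.1).minFac : ℝ) ^ (-2 : ℝ) + C, ?_⟩
  filter_upwards [hC, eventually_summable_absNorm_rpow K, self_mem_nhdsWithin] with s hC hs h1
  have h1 : 1 < s := h1
  have hle (P : Ideal (𝓞 K)) (hP : Prime P) : (absNorm P : ℝ) ^ (-s) ≤ 1 / 2 := by
    refine (absNorm_rpow_le_minFac_rpow hP h1.le).trans ?_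
    have : (2 : ℝ) ≤ (absNorm P).minFac := by
      exact_mod_cast (exists_prime_absNorm_eq_pow hP).1.two_le
    rw [Real.rpow_neg_one, one_div]
    exact inv_anti₀ two_pos this
  have key := abs_tsum_primes_sub_log_tsum_le (w := fun I : Ideal (𝓞 K) ↦ (absNorm I : ℝ) ^ (-s))
    (fun I ↦ by positivity) hs (by simp [Real.zero_rpow (by linarith : -s ≠ 0)]) (by simp)
    (fun I J ↦ by rw [map_mul, Nat.cast_mul, Real.mul_rpow (by positivity) (by positivity)]) hle
  have hsq (P : {P : Ideal (𝓞 K) // Prime P}) :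
      ((absNorm P.1 : ℝ) ^ (-s)) ^ 2 ≤ ((absNorm P.1).minFac : ℝ) ^ (-2 : ℝ) := by
    refine (pow_le_pow_left₀ (by positivity) (absNorm_rpow_le_minFac_rpow P.2 h1.le) 2).trans ?_
    rw [← Real.rpow_natCast, ← Real.rpow_mul (by positivity)]
    norm_num
  have hsum := (hB.of_nonneg_of_le (fun P ↦ by positivity) hsq).tsum_le_tsum hsq hB
  rw [abs_le] at *
  constructor <;> linarith

theorem finite_fiber_absNorm_prime (n : ℕ) :
    Finite {P : {P : Ideal (𝓞 K) // Prime P} // absNorm P.1 = n} :=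
  have := (finite_setOfPred_absNorm_eq (S := 𝓞 K) n).to_subtype
  Finite.of_injective (β := {I : Ideal (𝓞 K) | absNorm I = n}) (fun P ↦ ⟨P.1.1, P.2⟩)
    fun _ _ h ↦ Subtype.ext (Subtype.ext (congrArg Subtype.val h :))

variable (K) in
theorem exists_eventually_abs_tsum_card_absNorm_prime_add_log_le :
    ∃ C : ℝ, ∀ᶠ s : ℝ in 𝓝[>] 1,
      |∑' n : ℕ, (Nat.card {P : {P : Ideal (𝓞 K) // Prime P} // absNorm P.1 = n} : ℝ) *
        primeWeight s n + Real.log (s - 1)| ≤ C := by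
  obtain ⟨C, hC⟩ := exists_eventually_abs_tsum_prime_ideals_add_log_le K
  have hB := summable_minFac_absNorm_rpow_neg_two K
  refine ⟨∑' P : {P : Ideal (𝓞 K) // Prime P}, ((absNorm P.1).minFac : ℝ) ^ (-2 : ℝ) + C, ?_⟩
  filter_upwards [hC, eventually_summable_absNorm_rpow K, self_mem_nhdsWithin] with s hC hs h1
  have h1 : 1 < s := h1
  have hh (n : ℕ) : 0 ≤ primeWeight s n := primeWeight_nonneg s n
  rw [← tsum_comp_eq_tsum_card_fiber_mul (g := fun P : {P : Ideal (𝓞 K) // Prime P} ↦ absNorm P.1)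
    finite_fiber_absNorm_prime hh]
  have hs' : Summable fun P : {P : Ideal (𝓞 K) // Prime P} ↦ (absNorm P.1 : ℝ) ^ (-s) :=
    hs.subtype _
  have hle (P : {P : Ideal (𝓞 K) // Prime P}) :
      primeWeight s (absNorm P.1) ≤ (absNorm P.1 : ℝ) ^ (-s) := by
    rw [primeWeight]
    split_ifs
    · exact le_rfl
    · positivity
  have hge (P : {P : Ideal (𝓞 K) // Prime P}) :
      (absNorm P.1 : ℝ) ^ (-s) ≤ primeWeight s (absNorm P.1) +
        ((absNorm P.1).minFac : ℝ) ^ (-2 : ℝ) := by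
    rw [primeWeight]
    split_ifs with hp
    · exact le_add_of_nonneg_right (by positivity)
    · rw [zero_add]
      exact absNorm_rpow_le_minFac_rpow_neg_two P.2 hp h1.le
  have hs'' := hs'.of_nonneg_of_le (fun P ↦ hh _) hle
  have h2 := hs''.tsum_le_tsum hle hs'
  have h3 := hs'.tsum_le_tsum hge (hs''.add hB)
  rw [hs''.tsum_add hB] at h3
  rw [abs_le] at *
  constructor <;> linarith

end PrimeIdeals

section Roots
open Polynomial NumberField Ideal RingOfIntegers UniqueFactorizationMonoid Filter Topology

/-- The number of roots of an integer polynomial modulo `p`. -/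
noncomputable def rootCount (f : ℤ[X]) (p : ℕ) : ℕ := Nat.card {r : ZMod p // aeval r f = 0}

theorem rootCount_eq_card_roots (f : ℤ[X]) {p : ℕ} [Fact p.Prime]
    (hf : f.map (Int.castRingHom (ZMod p)) ≠ 0) :
    rootCount f p = (f.map (Int.castRingHom (ZMod p))).roots.toFinset.card := by
  rw [rootCount, ← Nat.card_eq_finsetCard]
  refine Nat.card_congr (Equiv.subtypeEquivRight fun r ↦ ?_)
  rw [Multiset.mem_toFinset, mem_roots hf, IsRoot, eval_map, aeval_def]
  rfl

theorem rootCount_le_natDegree {f : ℤ[X]} (hf : f.Monic) {p : ℕ} (hp : p.Prime) :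
    rootCount f p ≤ f.natDegree := by
  have : Fact p.Prime := ⟨hp⟩
  rw [rootCount_eq_card_roots f (hf.map _).ne_zero]
  exact (Multiset.toFinset_card_le _).trans ((card_roots' _).trans natDegree_map_le)

variable {K : Type*} [Field K] [NumberField K]

theorem exponent_ne_zero_of_adjoin_eq_top {θ : 𝓞 K} (hθ : Algebra.adjoin ℚ {(θ : K)} = ⊤) :
    exponent θ ≠ 0 := by
  have hne : conductor ℤ θ ≠ ⊥ := by
    intro h
    have key := conductor_mul_differentIdeal ℤ ℚ K θ hθ
    rw [h, Ideal.bot_mul, eq_comm, span_singleton_eq_bot] at key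
    have hint : IsIntegral ℤ θ := θ.isIntegral
    have hdeg := minpoly.natDegree_pos hint
    have hder : derivative (minpoly ℤ θ) ≠ 0 := by
      intro h0
      exact hdeg.ne' (derivative_eq_zero.1 h0)
    exact (minpoly.IsIntegrallyClosed.degree_le_of_ne_zero (s := θ) hder key).not_gt
      (degree_derivative_lt (minpoly.ne_zero hint))
  rw [exponent, Ne, absNorm_eq_zero_iff]
  exact under_ne_bot ℤ hne

theorem card_absNorm_eq_prime_eq_rootCount {θ : 𝓞 K} {p : ℕ} (hp : p.Prime)
    (hθ : ¬ p ∣ exponent θ) :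
    Nat.card {P : {P : Ideal (𝓞 K) // Prime P} // absNorm P.1 = p} =
      rootCount (minpoly ℤ θ) p := by
  have : Fact p.Prime := ⟨hp⟩
  have hp0 : span {(p : ℤ)} ≠ ⊥ := by simpa using hp.ne_zero
  let e₁ : {P : {P : Ideal (𝓞 K) // Prime P} // absNorm P.1 = p} ≃
      {Q : primesOver (span {(p : ℤ)}) (𝓞 K) // Q.1.inertiaDeg ℤ = 1} :=
    { toFun P := ⟨⟨P.1.1, isPrime_of_prime P.1.2, by
          have := (exists_prime_absNorm_eq_pow P.1.2).2.1
          rwa [P.2, hp.minFac_eq] at this⟩, by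
          have h := exists_prime_absNorm_eq_pow P.1.2
          have := isPrime_of_prime P.1.2
          have := h.2.1
          rw [P.2, hp.minFac_eq] at this
          have h := pow_inertiaDeg p P.1.1
          rw [P.2] at h
          exact Nat.pow_right_injective hp.two_le (h.trans (pow_one p).symm)⟩
      invFun Q := ⟨⟨Q.1.1, (prime_iff_isPrime (ne_bot_of_mem_primesOver hp0 Q.1.2)).2 Q.1.2.1⟩, by
          have := Q.1.2.1
          have := Q.1.2.2
          have h := pow_inertiaDeg p Q.1.1
          rw [Q.2, pow_one] at h
          exact h.symm⟩
      left_inv P := rfl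
      right_inv Q := rfl }
  let e₂ : {Q : primesOver (span {(p : ℤ)}) (𝓞 K) // Q.1.inertiaDeg ℤ = 1} ≃
      {Q : monicFactorsMod θ p // Q.1.natDegree = 1} :=
    (NumberField.Ideal.primesOverSpanEquivMonicFactorsMod hθ).subtypeEquiv fun Q ↦ by
      rw [← NumberField.Ideal.inertiaDeg_primesOverSpanEquivMonicFactorsMod_symm_apply' hθ
        (NumberField.Ideal.primesOverSpanEquivMonicFactorsMod hθ Q).2]
      simp
  have hg0 : (minpoly ℤ θ).map (Int.castRingHom (ZMod p)) ≠ 0 :=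
    ((minpoly.monic θ.isIntegral).map _).ne_zero
  let φ : {r : ZMod p // aeval r (minpoly ℤ θ) = 0} →
      {Q : monicFactorsMod θ p // Q.1.natDegree = 1} := fun r ↦
    ⟨⟨X - C r.1, by
      rw [Multiset.mem_toFinset, mem_normalizedFactors_iff' hg0]
      refine ⟨irreducible_X_sub_C _, (monic_X_sub_C _).normalize_eq_self, ?_⟩
      rw [dvd_iff_isRoot, IsRoot, eval_map]
      exact r.2⟩, natDegree_X_sub_C _⟩
  have hφ : φ.Bijective := by
    constructor
    · intro r t h
      have h : X - C r.1 = X - C t.1 := congrArg (fun Q ↦ Q.1.1) h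
      exact Subtype.ext (C_injective (sub_right_injective h))
    · rintro ⟨⟨Q, hQ⟩, hdeg⟩
      rw [Multiset.mem_toFinset, mem_normalizedFactors_iff' hg0] at hQ
      have hmon : Q.Monic := by
        rw [← hQ.2.1]
        exact monic_normalize hQ.1.ne_zero
      have hX : Q = X - C (-Q.coeff 0) := by
        rw [C_neg, sub_neg_eq_add]
        exact hmon.eq_X_add_C hdeg
      refine ⟨⟨-Q.coeff 0, ?_⟩, Subtype.ext (Subtype.ext hX.symm)⟩
      have hd := hQ.2.2
      rw [hX, dvd_iff_isRoot, IsRoot, eval_map] at hd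
      exact hd
  exact Nat.card_congr ((e₁.trans e₂).trans (Equiv.ofBijective φ hφ).symm)

theorem exists_eventually_abs_tsum_rootCount_minpoly_add_log_le {θ : 𝓞 K}
    (hθ : Algebra.adjoin ℚ {(θ : K)} = ⊤) :
    ∃ C : ℝ, ∀ᶠ s : ℝ in 𝓝[>] 1,
      |∑' n : ℕ, (rootCount (minpoly ℤ θ) n : ℝ) * primeWeight s n + Real.log (s - 1)| ≤ C := by
  obtain ⟨C, hC⟩ := exists_eventually_abs_tsum_card_absNorm_prime_add_log_le K
  let u (n : ℕ) : ℝ := rootCount (minpoly ℤ θ) n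
  let v (n : ℕ) : ℝ := Nat.card {P : {P : Ideal (𝓞 K) // Prime P} // absNorm P.1 = n}
  let S := (exponent θ).divisors
  have huv (n : ℕ) (hn : n.Prime) (hS : n ∉ S) : u n = v n := by
    have : ¬ n ∣ exponent θ := fun h ↦
      hS (Nat.mem_divisors.2 ⟨h, exponent_ne_zero_of_adjoin_eq_top hθ⟩)
    simp only [u, v, card_absNorm_eq_prime_eq_rootCount hn this]
  refine ⟨∑ n ∈ S, |u n - v n| + C, ?_⟩
  filter_upwards [hC, self_mem_nhdsWithin] with s hC h1
  have h1 : 1 < s := h1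
  have hu : Summable fun n ↦ u n * primeWeight s n :=
    summable_mul_primeWeight h1 (fun n ↦ Nat.cast_nonneg _) fun n hn ↦
      Nat.cast_le.2 (rootCount_le_natDegree (minpoly.monic θ.isIntegral) hn)
  have hv : Summable fun n ↦ v n * primeWeight s n := by
    refine hu.congr_cofinite (S.finite_toSet.subset fun n hn ↦ by_contra fun hS ↦ hn ?_)
    by_cases hp : n.Prime
    · exact congrArg (· * primeWeight s n) (huv n hp hS)
    · simp [primeWeight, hp]
  have h2 := tsum_mul_primeWeight_le (by linarith) S (fun n hn hS ↦ (huv n hn hS).le) hu hv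
  have h3 := tsum_mul_primeWeight_le (by linarith) S (fun n hn hS ↦ (huv n hn hS).ge) hv hu
  simp_rw [abs_sub_comm (v _)] at h3
  rw [abs_le] at *
  constructor <;> linarith

theorem exists_eventually_abs_tsum_rootCount_add_log_le {f : ℤ[X]} (hf : f.Monic)
    (hirr : Irreducible f) :
    ∃ C : ℝ, ∀ᶠ s : ℝ in 𝓝[>] 1,
      |∑' n : ℕ, (rootCount f n : ℝ) * primeWeight s n + Real.log (s - 1)| ≤ C := by
  have : Fact (Irreducible (f.map (algebraMap ℤ ℚ))) :=
    ⟨(hf.irreducible_iff_irreducible_map_fraction_map).1 hirr⟩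
  let K := AdjoinRoot (f.map (algebraMap ℤ ℚ))
  have hroot : aeval (AdjoinRoot.root (f.map (algebraMap ℤ ℚ))) f = 0 := by
    rw [← aeval_map_algebraMap ℚ, aeval_def]
    exact AdjoinRoot.eval₂_root _
  have hint : IsIntegral ℤ (AdjoinRoot.root (f.map (algebraMap ℤ ℚ))) := ⟨f, hf, hroot⟩
  let θ : 𝓞 K := ⟨AdjoinRoot.root _, hint⟩
  have hθ : aeval θ f = 0 := by
    apply RingOfIntegers.coe_injective
    rw [map_zero, ← hroot]
    exact (aeval_algebraMap_apply K θ f).symm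
  have hmin : minpoly ℤ θ = f := by
    refine eq_of_monic_of_associated (minpoly.monic θ.isIntegral) hf ?_
    exact ((minpoly.irreducible θ.isIntegral).associated_of_dvd hirr
      (minpoly.isIntegrallyClosed_dvd θ.isIntegral hθ))
  rw [← hmin]
  exact exists_eventually_abs_tsum_rootCount_minpoly_add_log_le AdjoinRoot.adjoinRoot_eq_top

/-- If irreducible polynomials `f i` have altogether no more roots than the `g k` modulo almost
every prime, then there are no more `f i` than `g k`. -/
theorem card_le_card_of_sum_rootCount_le {ι κ : Type*} [Fintype ι] [Fintype κ] {f : ι → ℤ[X]}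
    {g : κ → ℤ[X]} (hf : ∀ i, (f i).Monic ∧ Irreducible (f i))
    (hg : ∀ k, (g k).Monic ∧ Irreducible (g k)) (S : Finset ℕ)
    (h : ∀ p : ℕ, p.Prime → p ∉ S → ∑ i, rootCount (f i) p ≤ ∑ k, rootCount (g k) p) :
    Fintype.card ι ≤ Fintype.card κ := by
  choose A hA using fun i ↦ exists_eventually_abs_tsum_rootCount_add_log_le (hf i).1 (hf i).2
  choose B hB using fun k ↦ exists_eventually_abs_tsum_rootCount_add_log_le (hg k).1 (hg k).2
  by_contra! hlt
  let u (n : ℕ) : ℝ := ∑ i, (rootCount (f i) n : ℝ)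
  let v (n : ℕ) : ℝ := ∑ k, (rootCount (g k) n : ℝ)
  let M := ∑ n ∈ S, |u n - v n| + ∑ i, A i + ∑ k, B k
  have htend : Tendsto (fun s : ℝ ↦ Real.log (s - 1)) (𝓝[>] 1) atBot := by
    refine Real.tendsto_log_nhdsGT_zero.comp ?_
    refine tendsto_nhdsWithin_iff.2 ⟨?_, ?_⟩
    · refine tendsto_nhdsWithin_of_tendsto_nhds ?_
      exact (continuous_sub_right (1 : ℝ)).tendsto' 1 0 (sub_self 1)
    · filter_upwards [self_mem_nhdsWithin] with s hs
      exact sub_pos.2 (show 1 < s from hs)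
  obtain ⟨s, hA, hB, hlog, h1⟩ := ((eventually_all.2 hA).and ((eventually_all.2 hB).and
    ((htend.eventually_lt_atBot (-|M|)).and self_mem_nhdsWithin))).exists
  have h1 : 1 < s := h1
  have hsum {F : ℤ[X]} (hF : F.Monic) :
      Summable fun n : ℕ ↦ (rootCount F n : ℝ) * primeWeight s n :=
    summable_mul_primeWeight h1 (fun n ↦ Nat.cast_nonneg _) fun n hn ↦
      Nat.cast_le.2 (rootCount_le_natDegree hF hn)
  have key := tsum_mul_primeWeight_le (u := u) (v := v) (by linarith) S
    (fun n hn hS ↦ by simpa only [u, v, ← Nat.cast_sum, Nat.cast_le] using h n hn hS)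
    (by simpa only [u, Finset.sum_mul] using summable_sum fun i _ ↦ hsum (hf i).1)
    (by simpa only [v, Finset.sum_mul] using summable_sum fun k _ ↦ hsum (hg k).1)
  simp only [u, v, Finset.sum_mul] at key
  rw [Summable.tsum_finsetSum fun i _ ↦ hsum (hf i).1,
    Summable.tsum_finsetSum fun k _ ↦ hsum (hg k).1] at key
  have hA' := Finset.sum_le_sum fun i (_ : i ∈ Finset.univ) ↦ (abs_le.1 (hA i)).1
  have hB' := Finset.sum_le_sum fun k (_ : k ∈ Finset.univ) ↦ (abs_le.1 (hB k)).2
  simp only [Finset.sum_add_distrib, Finset.sum_neg_distrib, Finset.sum_const, Finset.card_univ,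
    nsmul_eq_mul] at hA' hB'
  have hcard : (Fintype.card κ : ℝ) + 1 ≤ Fintype.card ι := by exact_mod_cast hlt
  have hM := le_abs_self M
  have hM0 := abs_nonneg M
  simp only [M, u, v] at hM
  nlinarith

end Roots

section CyclicGroup
variable {G : Type*} [CommGroup G] [IsCyclic G] [Finite G] {ℓ : ℕ}

theorem card_pow_eq_pow (ℓ : ℕ) (b : G) :
    Nat.card {u : G // u ^ ℓ = b ^ ℓ} = (Nat.card G).gcd ℓ := by
  rw [← IsCyclic.card_powMonoidHom_ker]
  exact Nat.card_congr ((powMonoidHom ℓ : G →* G).fiberEquivKer b)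

theorem card_pow_eq_one_of_not_dvd_card (hℓ : ℓ.Prime) (hG : ¬ ℓ ∣ Nat.card G) (a : G) :
    Nat.card {u : G // u ^ ℓ = a} = 1 := by
  have hco : (Nat.card G).Coprime ℓ := ((hℓ.coprime_iff_not_dvd).2 hG).symm
  obtain ⟨b, rfl⟩ := (powCoprime hco).surjective a
  rw [powCoprime_apply, card_pow_eq_pow, hco]

theorem card_pow_eq_of_pow_eq_one {m : ℕ} (hG : Nat.card G = ℓ * m) {a : G} (ha : a ^ m = 1) :
    Nat.card {u : G // u ^ ℓ = a} = ℓ := by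
  have hpos : 0 < ℓ * m := hG ▸ Nat.card_pos
  have hrange : (powMonoidHom ℓ : G →* G).range = (powMonoidHom m : G →* G).ker := by
    refine Subgroup.eq_of_le_of_card_ge ?_ ?_
    · rintro _ ⟨b, rfl⟩
      simp [MonoidHom.mem_ker, ← pow_mul, ← hG]
    · rw [IsCyclic.card_powMonoidHom_range, IsCyclic.card_powMonoidHom_ker, hG,
        Nat.gcd_mul_left_left, Nat.gcd_mul_right_left,
        Nat.mul_div_cancel_left _ (Nat.pos_of_mul_pos_right hpos)]
  obtain ⟨b, rfl⟩ : a ∈ (powMonoidHom ℓ : G →* G).range := hrange ▸ ha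
  rw [powMonoidHom_apply, card_pow_eq_pow, hG, Nat.gcd_mul_right_left]

theorem exists_mul_pow_eq_one {m : ℕ} (hℓ : ℓ.Prime) (hG : Nat.card G = ℓ * m) {x y : G}
    (hy : y ^ m ≠ 1) : ∃ j < ℓ, (x * y ^ j) ^ m = 1 := by
  have : Fact ℓ.Prime := ⟨hℓ⟩
  have hcard : Nat.card (powMonoidHom ℓ : G →* G).ker = ℓ := by
    rw [IsCyclic.card_powMonoidHom_ker, hG, Nat.gcd_mul_right_left]
  have hpow (z : G) : (z ^ m) ^ ℓ = 1 := by
    rw [← pow_mul, mul_comm, ← hG, pow_card_eq_one']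
  let κ (z : G) : (powMonoidHom ℓ : G →* G).ker := ⟨z ^ m, MonoidHom.mem_ker.2 (hpow z)⟩
  have hκ : κ y ≠ 1 := fun h ↦ hy (Subtype.ext_iff.1 h)
  obtain ⟨k, hk⟩ := Submonoid.mem_powers_iff _ _ |>.1 (mem_powers_of_prime_card (g' := κ x⁻¹) hcard hκ)
  replace hk : (y ^ m) ^ k = x⁻¹ ^ m := by simpa [κ] using Subtype.ext_iff.1 hk
  refine ⟨k % ℓ, Nat.mod_lt _ hℓ.pos, ?_⟩
  rw [mul_pow, pow_right_comm, ← pow_eq_pow_mod k (hpow y), hk, inv_pow, mul_inv_cancel]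

/-- The hypothesis on `x` and `y` forces many `ℓ`-th powers among `y` and the `x * y ^ j`. -/
theorem add_mul_card_pow_eq_le (hℓ : ℓ.Prime) (hG : ℓ ∣ Nat.card G) {x y : G}
    (h : ∀ m, 0 < m → x ^ m = 1 → y ^ m = 1) :
    ℓ + ℓ * Nat.card {u : G // u ^ ℓ = x} ≤
      Nat.card {u : G // u ^ ℓ = y} + ∑ j : Fin ℓ, Nat.card {u : G // u ^ ℓ = x * y ^ (j : ℕ)} := by
  obtain ⟨m, hm⟩ := hG
  have hm0 : 0 < m := Nat.pos_of_mul_pos_left (hm ▸ Nat.card_pos)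
  by_cases hx : x ^ m = 1
  · have hy := h m hm0 hx
    have hxy (j : Fin ℓ) : (x * y ^ (j : ℕ)) ^ m = 1 := by
      rw [mul_pow, hx, pow_right_comm, hy, one_pow, one_mul]
    simp [card_pow_eq_of_pow_eq_one hm hx, card_pow_eq_of_pow_eq_one hm hy,
      card_pow_eq_of_pow_eq_one hm (hxy _)]
  · have hempty : IsEmpty {u : G // u ^ ℓ = x} := by
      refine ⟨fun u ↦ hx ?_⟩
      rw [← u.2, ← pow_mul, ← hm, pow_card_eq_one']
    rw [Nat.card_of_isEmpty, mul_zero, add_zero]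
    by_cases hy : y ^ m = 1
    · rw [card_pow_eq_of_pow_eq_one hm hy]
      exact Nat.le_add_right _ _
    · obtain ⟨j, hj, hxy⟩ := exists_mul_pow_eq_one hℓ hm (x := x) hy
      have := Finset.single_le_sum (f := fun j : Fin ℓ ↦
        Nat.card {u : G // u ^ ℓ = x * y ^ (j : ℕ)}) (fun _ _ ↦ Nat.zero_le _)
        (Finset.mem_univ ⟨j, hj⟩)
      rw [card_pow_eq_of_pow_eq_one hm hxy] at this
      exact this.trans (Nat.le_add_left _ _)

end CyclicGroup

section Irreducible
open Polynomial

theorem dvd_padicValNat_of_pow_eq_natCast {q ℓ N : ℕ} [Fact q.Prime] {r : ℚ} (hN : N ≠ 0)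
    (h : r ^ ℓ = N) : (ℓ : ℤ) ∣ padicValNat q N := by
  have hr : r ≠ 0 ∨ ℓ = 0 := by
    by_contra! hr
    rw [hr.1, zero_pow hr.2] at h
    exact hN (by exact_mod_cast h.symm)
  rw [← padicValRat.of_nat, ← h, padicValRat.pow]
  exact dvd_mul_right _ _

theorem irreducible_X_pow_sub_C_of_not_dvd_padicValNat {q ℓ N : ℕ} (hℓ : ℓ.Prime) (hq : q.Prime)
    (hN : N ≠ 0) (h : ¬ ℓ ∣ padicValNat q N) : Irreducible (X ^ ℓ - C (N : ℤ) : ℤ[X]) := by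
  have : Fact q.Prime := ⟨hq⟩
  rw [(monic_X_pow_sub_C _ hℓ.ne_zero).irreducible_iff_irreducible_map_fraction_map (K := ℚ)]
  have hirr : Irreducible (X ^ ℓ - C (N : ℚ) : ℚ[X]) :=
    X_pow_sub_C_irreducible_of_prime hℓ fun r hr ↦
      h (Int.natCast_dvd_natCast.1 (dvd_padicValNat_of_pow_eq_natCast hN hr))
  simpa using hirr

end Irreducible

section Dependence

theorem exists_pow_eq_pow_of_padicValNat {X Y : ℕ} (hX : 2 ≤ X) (hY : 2 ≤ Y)
    (h : ∀ q r : ℕ, q.Prime → r.Prime →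
      padicValNat q X * padicValNat r Y = padicValNat r X * padicValNat q Y) :
    ∃ a f : ℕ, a ≠ 0 ∧ f ≠ 0 ∧ X ^ a = Y ^ f := by
  have hpos {N : ℕ} (hN : 2 ≤ N) : N.minFac.Prime ∧ padicValNat N.minFac N ≠ 0 := by
    have hp := Nat.minFac_prime (show N ≠ 1 by lia)
    have : Fact N.minFac.Prime := ⟨hp⟩
    exact ⟨hp, Nat.one_le_iff_ne_zero.1 (one_le_padicValNat_of_dvd (by lia) N.minFac_dvd)⟩
  obtain ⟨hq, hqY⟩ := hpos hY
  obtain ⟨hr, hrX⟩ := hpos hX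
  refine ⟨padicValNat Y.minFac Y, padicValNat Y.minFac X, hqY, fun h0 ↦ ?_, ?_⟩
  · have := h _ _ hq hr
    rw [h0, zero_mul] at this
    exact mul_ne_zero hrX hqY this.symm
  · refine Nat.eq_of_factorization_eq (by positivity) (by positivity) fun r ↦ ?_
    by_cases hr : r.Prime
    · simpa [Nat.factorization_pow, Nat.factorization_def _ hr, mul_comm] using (h _ _ hq hr).symm
    · simp [Nat.factorization_eq_zero_of_not_prime _ hr]

end Dependence

section Support
open Polynomial

theorem rootCount_X_pow_sub_C {ℓ p N : ℕ} [Fact p.Prime] (hℓ : ℓ ≠ 0) {a : (ZMod p)ˣ}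
    (ha : (a : ZMod p) = N) :
    rootCount (X ^ ℓ - C (N : ℤ)) p = Nat.card {u : (ZMod p)ˣ // u ^ ℓ = a} := by
  refine Nat.card_congr (Equiv.symm (Equiv.ofBijective (fun u ↦ ⟨u.1, ?_⟩) ⟨?_, ?_⟩))
  · simp [← ha, ← u.2]
  · intro u v h
    exact Subtype.ext (Units.ext (congrArg Subtype.val h :))
  · rintro ⟨r, hr⟩
    have hr : r ^ ℓ = a := by simpa [← ha, sub_eq_zero] using hr
    have hr0 : r ≠ 0 := by
      rintro rfl
      rw [zero_pow hℓ] at hr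
      exact a.ne_zero hr.symm
    exact ⟨⟨Units.mk0 r hr0, Units.ext (by simpa using hr)⟩, rfl⟩

theorem rootCount_X (p : ℕ) : rootCount X p = 1 := by
  simp [rootCount]

theorem rootCount_cyclotomic_of_not_dvd {ℓ p : ℕ} [Fact p.Prime] (hpℓ : ¬ p ∣ ℓ)
    (h : ¬ ℓ ∣ Nat.card (ZMod p)ˣ) : rootCount (cyclotomic ℓ ℤ) p = 0 := by
  have : NeZero (ℓ : ZMod p) := ⟨by rwa [Ne, ZMod.natCast_eq_zero_iff]⟩
  have hempty : IsEmpty {r : ZMod p // aeval r (cyclotomic ℓ ℤ) = 0} := by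
    refine ⟨fun ⟨r, hr⟩ ↦ h ?_⟩
    have hr : IsPrimitiveRoot r ℓ := by
      rw [← isRoot_cyclotomic_iff, ← map_cyclotomic_int, IsRoot, eval_map]
      exact hr
    have hℓ : ℓ ≠ 0 := by
      rintro rfl
      exact hpℓ (dvd_zero p)
    obtain ⟨u, rfl⟩ := hr.isUnit hℓ
    rw [IsPrimitiveRoot.coe_units_iff] at hr
    exact hr.eq_orderOf ▸ orderOf_dvd_natCard u
  exact Nat.card_of_isEmpty

theorem sum_rootCount_le_of_support {X Y ℓ p : ℕ} (hℓ : ℓ.Prime) (hp : p.Prime) (hpℓ : ¬ p ∣ ℓ)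
    (hX : ¬ p ∣ X) (hY : ¬ p ∣ Y)
    (h : ∀ m : ℕ, 0 < m → (p : ℤ) ∣ (X : ℤ) ^ m - 1 → (p : ℤ) ∣ (Y : ℤ) ^ m - 1) :
    rootCount Polynomial.X p + (rootCount (cyclotomic ℓ ℤ) p +
        ℓ * rootCount (Polynomial.X ^ ℓ - C (X : ℤ)) p) ≤
      rootCount (Polynomial.X ^ ℓ - C (Y : ℤ)) p +
        ∑ j : Fin ℓ, rootCount (Polynomial.X ^ ℓ - C ((X * Y ^ (j : ℕ) : ℕ) : ℤ)) p := by
  have : Fact p.Prime := ⟨hp⟩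
  let x : (ZMod p)ˣ := Units.mk0 (X : ZMod p) (by rwa [Ne, ZMod.natCast_eq_zero_iff])
  let y : (ZMod p)ˣ := Units.mk0 (Y : ZMod p) (by rwa [Ne, ZMod.natCast_eq_zero_iff])
  have hxy (j : ℕ) : ((x * y ^ j : (ZMod p)ˣ) : ZMod p) = (X * Y ^ j : ℕ) := by simp [x, y]
  rw [rootCount_X, rootCount_X_pow_sub_C hℓ.ne_zero (a := x) rfl,
    rootCount_X_pow_sub_C hℓ.ne_zero (a := y) rfl]
  simp_rw [fun j : Fin ℓ ↦ rootCount_X_pow_sub_C hℓ.ne_zero (hxy j)]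
  by_cases hdvd : ℓ ∣ Nat.card (ZMod p)ˣ
  · have hcyc := rootCount_le_natDegree (cyclotomic.monic ℓ ℤ) hp
    rw [natDegree_cyclotomic, Nat.totient_prime hℓ] at hcyc
    have hone {Z : ℕ} {z : (ZMod p)ˣ} (hz : (z : ZMod p) = Z) (m : ℕ) :
        z ^ m = 1 ↔ (p : ℤ) ∣ (Z : ℤ) ^ m - 1 := by
      rw [← ZMod.intCast_zmod_eq_zero_iff_dvd, Units.ext_iff]
      simp [hz, sub_eq_zero]
    have key := add_mul_card_pow_eq_le hℓ hdvd (x := x) (y := y) fun m hm hx ↦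
      (hone (Z := Y) rfl m).2 (h m hm ((hone (Z := X) rfl m).1 hx))
    have := hℓ.pos
    lia
  · rw [rootCount_cyclotomic_of_not_dvd hpℓ hdvd]
    simp only [card_pow_eq_one_of_not_dvd_card hℓ hdvd]
    simp [add_comm]

theorem exists_pow_eq_pow_of_support {X Y : ℕ} (hX : 2 ≤ X) (hY : 2 ≤ Y) (T : Finset ℕ)
    (hsupp : ∀ p : ℕ, p.Prime → p ∉ T → ∀ m : ℕ, 0 < m →
      (p : ℤ) ∣ (X : ℤ) ^ m - 1 → (p : ℤ) ∣ (Y : ℤ) ^ m - 1) :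
    ∃ a f : ℕ, a ≠ 0 ∧ f ≠ 0 ∧ X ^ a = Y ^ f := by
  classical
  refine exists_pow_eq_pow_of_padicValNat hX hY fun q r hq hr ↦ ?_
  by_contra hne
  have : Fact q.Prime := ⟨hq⟩
  have : Fact r.Prime := ⟨hr⟩
  let D : ℤ := padicValNat q X * padicValNat r Y - padicValNat r X * padicValNat q Y
  have hD : D ≠ 0 := sub_ne_zero.2 (by exact_mod_cast hne)
  obtain ⟨ℓ, hℓD, hℓ⟩ := Nat.exists_infinite_primes (D.natAbs + 1)
  have hℓD : ¬ (ℓ : ℤ) ∣ D := fun h ↦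
    (Nat.le_of_dvd (Int.natAbs_pos.2 hD) (Int.natCast_dvd.1 h)).not_gt hℓD
  have hirr (N : ℕ) (hN : N ≠ 0) (h : (ℓ : ℤ) ∣ padicValNat q N → (ℓ : ℤ) ∣ padicValNat r N →
      (ℓ : ℤ) ∣ D) : Irreducible (Polynomial.X ^ ℓ - C (N : ℤ) : ℤ[X]) := by
    by_cases hqN : ℓ ∣ padicValNat q N
    · exact irreducible_X_pow_sub_C_of_not_dvd_padicValNat hℓ hr hN fun hrN ↦
        hℓD (h (Int.natCast_dvd_natCast.2 hqN) (Int.natCast_dvd_natCast.2 hrN))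
    · exact irreducible_X_pow_sub_C_of_not_dvd_padicValNat hℓ hq hN hqN
  have hX0 : X ≠ 0 := by lia
  have hY0 : Y ≠ 0 := by lia
  have hirrY : Irreducible (Polynomial.X ^ ℓ - C (Y : ℤ) : ℤ[X]) :=
    hirr Y hY0 fun h1 h2 ↦ dvd_sub (h2.mul_left _) (h1.mul_left _)
  have hirrXY (j : ℕ) : Irreducible (Polynomial.X ^ ℓ - C ((X * Y ^ j : ℕ) : ℤ) : ℤ[X]) := by
    refine hirr _ (by positivity) fun h1 h2 ↦ ?_
    rw [padicValNat.mul hX0 (by positivity), padicValNat.pow, Nat.cast_add, Nat.cast_mul]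
      at h1 h2
    have : D = (padicValNat q X + j * padicValNat q Y) * padicValNat r Y -
        (padicValNat r X + j * padicValNat r Y) * padicValNat q Y := by
      simp only [D]
      ring
    exact this ▸ dvd_sub (h1.mul_right _) (h2.mul_right _)
  have hirrX : Irreducible (Polynomial.X ^ ℓ - C (X : ℤ) : ℤ[X]) := by simpa using hirrXY 0
  let f : Option (Option (Fin ℓ)) → ℤ[X] := fun i ↦
    i.elim Polynomial.X fun i ↦ i.elim (cyclotomic ℓ ℤ) fun _ ↦ Polynomial.X ^ ℓ - C (X : ℤ)
  let g : Option (Fin ℓ) → ℤ[X] := fun k ↦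
    k.elim (Polynomial.X ^ ℓ - C (Y : ℤ)) fun j ↦
      Polynomial.X ^ ℓ - C ((X * Y ^ (j : ℕ) : ℕ) : ℤ)
  have hf (i) : (f i).Monic ∧ Irreducible (f i) := by
    match i with
    | none => exact ⟨monic_X, irreducible_X⟩
    | some none => exact ⟨cyclotomic.monic ℓ ℤ, cyclotomic.irreducible hℓ.pos⟩
    | some (some _) => exact ⟨monic_X_pow_sub_C _ hℓ.ne_zero, hirrX⟩
  have hg (k) : (g k).Monic ∧ Irreducible (g k) := by
    match k with
    | none => exact ⟨monic_X_pow_sub_C _ hℓ.ne_zero, hirrY⟩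
    | some j => exact ⟨monic_X_pow_sub_C _ hℓ.ne_zero, hirrXY j⟩
  have hcard := card_le_card_of_sum_rootCount_le hf hg (T ∪ (ℓ * X * Y).divisors)
    fun p hp hpT ↦ by
      rw [Finset.mem_union, not_or, Nat.mem_divisors] at hpT
      have hdvd : ¬ p ∣ ℓ * X * Y := fun h ↦
        hpT.2 ⟨h, mul_ne_zero (mul_ne_zero hℓ.ne_zero hX0) hY0⟩
      rw [hp.dvd_mul, hp.dvd_mul, not_or, not_or] at hdvd
      simpa [f, g, Fintype.sum_option] using
        sum_rootCount_le_of_support hℓ hp hdvd.1.1 hdvd.1.2 hdvd.2 (hsupp p hp hpT.1)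
  simp at hcard

end Support

theorem erdos_support_problem
    (x y : ℤ) (hx : 2 ≤ x) (hy : 2 ≤ y)
    (T : Finset ℕ)
    (hsupp : ∀ p : ℕ, p.Prime → p ∉ T → ∀ m : ℕ, 0 < m →
      (p : ℤ) ∣ x ^ m - 1 → (p : ℤ) ∣ y ^ m - 1) :
    ∃ a f : ℤ, a ≠ 0 ∧ f ≠ 0 ∧ (x : ℚ) ^ a = (y : ℚ) ^ f := by
  lift x to ℕ using by lia
  lift y to ℕ using by lia
  obtain ⟨a, f, ha, hf, h⟩ :=
    exists_pow_eq_pow_of_support (by exact_mod_cast hx) (by exact_mod_cast hy) T hsupp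
  refine ⟨a, f, by exact_mod_cast ha, by exact_mod_cast hf, ?_⟩
  rw [zpow_natCast, zpow_natCast]
  exact_mod_cast h
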